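/- Existence and uniqueness of the μ-quantile map (Brenier–McCann): let μ and ν be Borel probability measures on ℝ^d with μ absolutely continuous with respect to Lebesgue measure. Then there exists a convex function φ : ℝ^d → ℝ ∪ {+∞}, differentiable μ-almost everywhere, such that the gradient map ∇φ pushes μ forward to ν (∇φ#μ = ν); moreover this map is unique in the sense that if φ̃ is another convex function with ∇φ̃#μ = ν, then ∇φ̃ = ∇φ μ-almost everywhere. -/

import Mathlib

open MeasureTheory

/-- Convexity for an `ℝ ∪ {+∞}`-valued (i.e. `EReal`-valued, never `⊥`) function. -/
def IsConvexEReal {E : Type*} [AddCommMonoid E] [Module ℝ E] (φ : E → EReal) : Prop :=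
  ∀ (x y : E) (t a b : ℝ), 0 ≤ t → t ≤ 1 → φ x ≤ (a : EReal) → φ y ≤ (b : EReal) →
    φ (t • x + (1 - t) • y) ≤ ((t * a + (1 - t) * b : ℝ) : EReal)

namespace BM
open Set Filter Topology
open scoped RealInnerProductSpace

theorem convexOn_toReal {E : Type*} [AddCommGroup E] [Module ℝ E] {φ : E → EReal}
    (hb : ∀ x, φ x ≠ ⊥) (h : IsConvexEReal φ) :
    ConvexOn ℝ {x | φ x ≠ ⊤} (fun x => (φ x).toReal) := by
  have key : ∀ x, φ x ≠ ⊤ → ∀ y, φ y ≠ ⊤ → ∀ a b : ℝ, 0 ≤ a → 0 ≤ b → a + b = 1 →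
      φ (a • x + b • y) ≤ ((a * (φ x).toReal + b * (φ y).toReal : ℝ) : EReal) := by
    intro x hx y hy a b ha hb' hab
    have := h x y a (φ x).toReal (φ y).toReal ha (by linarith)
      (EReal.le_coe_toReal hx) (EReal.le_coe_toReal hy)
    rwa [show 1 - a = b by linarith] at this
  refine ⟨?_, ?_⟩
  · intro x hx y hy a b ha hb' hab
    exact ne_top_of_le_ne_top (EReal.coe_ne_top _) (key x hx y hy a b ha hb' hab)
  · intro x hx y hy a b ha hb' hab
    have := EReal.toReal_le_toReal (key x hx y hy a b ha hb' hab) (hb _) (EReal.coe_ne_top _)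
    rw [EReal.toReal_coe] at this
    exact this

section Sub
variable {E : Type*} [NormedAddCommGroup E] [InnerProductSpace ℝ E] [CompleteSpace E]

theorem subgrad_of_hasGradientAt {D : Set E} {f : E → ℝ} (hf : ConvexOn ℝ D f) {x g : E}
    (hx : x ∈ D) (hg : HasGradientAt f g x) (z : E) (hz : z ∈ D) :
    f x + ⟪z - x, g⟫ ≤ f z := by
  have h1 : HasDerivAt (fun t : ℝ => f (x + t • (z - x))) (⟪z - x, g⟫) 0 := by
    have hl : HasDerivAt (fun t : ℝ => x + t • (z - x)) (z - x) 0 := by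
      simpa using ((hasDerivAt_id (0:ℝ)).smul_const (z - x)).const_add x
    have hg' : HasFDerivAt f (InnerProductSpace.toDual ℝ E g) (x + (0:ℝ) • (z - x)) := by
      simpa using hg.hasFDerivAt
    have := hg'.comp_hasDerivAt (0:ℝ) hl
    simpa [real_inner_comm, Function.comp_def] using this
  have h2 := h1.tendsto_slope_zero_right
  have : ⟪z - x, g⟫ ≤ f z - f x := by
    refine le_of_tendsto h2 ?_
    have : Ioo (0:ℝ) 1 ∈ 𝓝[>] (0:ℝ) := Ioo_mem_nhdsGT one_pos
    filter_upwards [this] with t ht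
    have hc := hf.2 hx hz (sub_nonneg.2 ht.2.le) ht.1.le (sub_add_cancel 1 t)
    have e : (1 - t) • x + t • z = x + (0 + t) • (z - x) := by module
    rw [e] at hc
    simp only [smul_eq_mul, zero_smul, add_zero] at hc ⊢
    rw [inv_mul_le_iff₀ ht.1]
    linarith
  linarith

theorem eq_grad_of_subgrad {D : Set E} {f : E → ℝ} {x g p : E}
    (hx : x ∈ interior D) (hg : HasGradientAt f g x)
    (hp : ∀ z ∈ D, f x + ⟪z - x, p⟫ ≤ f z) : p = g := by
  have h1 : HasFDerivAt (fun z => f z - ⟪z, p⟫)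
      (InnerProductSpace.toDual ℝ E g - InnerProductSpace.toDual ℝ E p) x := by
    refine hg.hasFDerivAt.sub ?_
    have := (InnerProductSpace.toDual ℝ E p).hasFDerivAt (x := x)
    have e : (fun z => ⟪z, p⟫) = (InnerProductSpace.toDual ℝ E p : E → ℝ) := by
      funext z; rw [InnerProductSpace.toDual_apply_apply, real_inner_comm]
    rw [e]; exact this
  have hmin : IsLocalMin (fun z => f z - ⟪z, p⟫) x := by
    filter_upwards [mem_interior_iff_mem_nhds.1 hx] with z hz
    have := hp z hz
    rw [inner_sub_left] at this
    linarith
  have := hmin.hasFDerivAt_eq_zero h1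
  rw [sub_eq_zero] at this
  exact ((InnerProductSpace.toDual ℝ E).injective this).symm
end Sub

theorem ae_diff {E : Type*} [NormedAddCommGroup E] [NormedSpace ℝ E] [FiniteDimensional ℝ E]
    [MeasurableSpace E] [BorelSpace E] (μ : Measure E) [μ.IsAddHaarMeasure]
    {D : Set E} {f : E → ℝ} (hf : ConvexOn ℝ D f) :
    ∀ᵐ x ∂μ, x ∈ interior D → DifferentiableAt ℝ f x := by
  have hl := hf.locallyLipschitzOn_interior
  have h : ∀ x ∈ interior D, ∃ U : Set E, IsOpen U ∧ x ∈ U ∧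
      ∀ᵐ y ∂μ, y ∈ U → DifferentiableAt ℝ f y := by
    intro x hx
    obtain ⟨K, t, ht, hK⟩ := hl hx
    rw [isOpen_interior.nhdsWithin_eq hx] at ht
    refine ⟨interior t, isOpen_interior, mem_interior_iff_mem_nhds.2 ht, ?_⟩
    have := (hK.mono interior_subset).ae_differentiableWithinAt_of_mem (μ := μ)
    filter_upwards [this] with y hy hy'
    exact (hy hy').differentiableAt (isOpen_interior.mem_nhds hy')
  choose! U hUo hxU hU using h
  obtain ⟨T, hTs, hTc, hT⟩ := TopologicalSpace.countable_cover_nhdsWithin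
    (s := interior D) (f := U) (fun x hx => mem_nhdsWithin_of_mem_nhds ((hUo x hx).mem_nhds (hxU x hx)))
  have : ∀ᵐ y ∂μ, ∀ x ∈ T, y ∈ U x → DifferentiableAt ℝ f y :=
    (ae_ball_iff hTc).2 fun x hx => hU x (hTs hx)
  filter_upwards [this] with y hy hyD
  obtain ⟨x, hx, hy'⟩ := mem_iUnion₂.1 (hT hyD)
  exact hy x hx hy'

section Uniq
variable {E : Type*} [NormedAddCommGroup E] [InnerProductSpace ℝ E]

/-- Legendre conjugate. -/
noncomputable def conj (D : Set E) (f : E → ℝ) (y : E) : EReal :=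
  ⨆ z ∈ D, ((⟪z, y⟫ - f z : ℝ) : EReal)

theorem conj_meas [MeasurableSpace E] [BorelSpace E] (D : Set E) (f : E → ℝ) :
    Measurable (conj D f) := by
  have : LowerSemicontinuous (conj D f) := by
    refine lowerSemicontinuous_biSup fun z _ => ?_
    refine Continuous.lowerSemicontinuous ?_
    exact continuous_coe_real_ereal.comp (by fun_prop)
  exact this.measurable

theorem le_conj {D : Set E} {f : E → ℝ} {z y : E} (hz : z ∈ D) :
    ((⟪z, y⟫ - f z : ℝ) : EReal) ≤ conj D f y := by
  unfold conj
  exact le_iSup₂ (f := fun z (_ : z ∈ D) => ((⟪z, y⟫ - f z : ℝ) : EReal)) z hz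

theorem conj_eq {D : Set E} {f : E → ℝ} {x y : E} (hx : x ∈ D)
    (h : ∀ z ∈ D, f x + ⟪z - x, y⟫ ≤ f z) : conj D f y = ((⟪x, y⟫ - f x : ℝ) : EReal) := by
  refine le_antisymm ?_ (le_conj hx)
  refine iSup₂_le fun z hz => ?_
  have := h z hz
  rw [inner_sub_left] at this
  exact_mod_cast (by linarith)

theorem ae_eq_of_map_eq {Ω : Type*} [MeasurableSpace Ω] {μ : Measure Ω} [IsProbabilityMeasure μ]
    {A B : Ω → ℝ} (hA : Measurable A) (hB : Measurable B) (hle : A ≤ᵐ[μ] B)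
    (hmap : μ.map A = μ.map B) : A =ᵐ[μ] B := by
  have hm : Measurable Real.arctan := Real.continuous_arctan.measurable
  have hi : ∀ {C : Ω → ℝ}, Measurable C → Integrable (fun x => Real.arctan (C x)) μ := by
    intro C hC
    refine Integrable.of_bound (hm.comp hC).aestronglyMeasurable (Real.pi / 2) ?_
    refine Eventually.of_forall fun x => ?_
    rw [Real.norm_eq_abs, abs_le]
    exact ⟨by linarith [Real.neg_pi_div_two_lt_arctan (C x)], (Real.arctan_lt_pi_div_two _).le⟩
  have h1 : ∫ x, Real.arctan (A x) ∂μ = ∫ x, Real.arctan (B x) ∂μ := by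
    rw [← integral_map hA.aemeasurable hm.aestronglyMeasurable,
      ← integral_map hB.aemeasurable hm.aestronglyMeasurable, hmap]
  have h2 := (integral_eq_iff_of_ae_le (hi hA) (hi hB) (by
    filter_upwards [hle] with x hx
    exact Real.arctan_strictMono.monotone hx)).1 h1
  filter_upwards [h2] with x hx
  exact Real.arctan_injective hx

theorem uniq_core [MeasurableSpace E] [BorelSpace E] {μ : Measure E} [IsProbabilityMeasure μ]
    {D D' : Set E} {f f' : E → ℝ} {T T' : E → E} (hT : Measurable T) (hT' : Measurable T')
    (h : ∀ᵐ x ∂μ, x ∈ D ∧ ∀ z ∈ D, f x + ⟪z - x, T x⟫ ≤ f z)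
    (h' : ∀ᵐ x ∂μ, x ∈ D' ∧ ∀ z ∈ D', f' x + ⟪z - x, T' x⟫ ≤ f' z)
    (hmap : μ.map T' = μ.map T) :
    ∀ᵐ x ∂μ, ∀ z ∈ D, f x + ⟪z - x, T' x⟫ ≤ f z := by
  have hfin : ∀ {D : Set E} {f : E → ℝ} {T T' : E → E}, Measurable T → Measurable T' →
      (∀ᵐ x ∂μ, x ∈ D ∧ ∀ z ∈ D, f x + ⟪z - x, T x⟫ ≤ f z) → μ.map T' = μ.map T →
      ∀ᵐ x ∂μ, conj D f (T' x) ≠ ⊤ := by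
    intro D f T T' hT hT' h hmap
    have hs : MeasurableSet {y | conj D f y ≠ ⊤} :=
      (conj_meas D f) (measurableSet_singleton ⊤).compl
    have : ∀ᵐ y ∂(μ.map T), conj D f y ≠ ⊤ := by
      rw [ae_map_iff hT.aemeasurable hs]
      filter_upwards [h] with x hx
      rw [conj_eq hx.1 hx.2]
      exact EReal.coe_ne_top _
    rw [← hmap, ae_map_iff hT'.aemeasurable hs] at this
    exact this
  set H : E → ℝ := fun y => (conj D f y).toReal - (conj D' f' y).toReal with hH
  have hHm : Measurable H :=
    (conj_meas D f).ereal_toReal.sub (conj_meas D' f').ereal_toReal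
  have f1 := hfin hT hT' h hmap
  have f2 := hfin hT' hT h' hmap.symm
  have e1 : ∀ᵐ x ∂μ, H (T x) ≤ f' x - f x := by
    filter_upwards [h, h', f2] with x hx hx' hf2
    have a1 : (conj D f (T x)).toReal = ⟪x, T x⟫ - f x := by rw [conj_eq hx.1 hx.2]; rfl
    have a2 := EReal.toReal_le_toReal (le_conj (f := f') (y := T x) hx'.1) (EReal.coe_ne_bot _) hf2
    rw [EReal.toReal_coe] at a2
    simp only [hH]; linarith
  have e2 : ∀ᵐ x ∂μ, f' x - f x ≤ H (T' x) := by
    filter_upwards [h, h', f1] with x hx hx' hf2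
    have a1 : (conj D' f' (T' x)).toReal = ⟪x, T' x⟫ - f' x := by rw [conj_eq hx'.1 hx'.2]; rfl
    have a2 := EReal.toReal_le_toReal (le_conj (f := f) (y := T' x) hx.1) (EReal.coe_ne_bot _) hf2
    rw [EReal.toReal_coe] at a2
    simp only [hH]; linarith
  have e3 := ae_eq_of_map_eq (μ := μ) (hHm.comp hT) (hHm.comp hT')
    (by filter_upwards [e1, e2] with x h1 h2 using h1.trans h2)
    (by rw [← Measure.map_map hHm hT, ← Measure.map_map hHm hT', hmap])
  filter_upwards [h, h', f1, e1, e2, e3] with x hx hx' hf1 h1 h2 h3 z hz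
  simp only [Function.comp] at h3
  have a1 : (conj D' f' (T' x)).toReal = ⟪x, T' x⟫ - f' x := by rw [conj_eq hx'.1 hx'.2]; rfl
  have a2 := EReal.toReal_le_toReal (le_conj (f := f) (y := T' x) hz) (EReal.coe_ne_bot _) hf1
  rw [EReal.toReal_coe] at a2
  have a3 : H (T' x) = f' x - f x := le_antisymm (h3 ▸ h1) h2
  simp only [hH] at a3
  rw [inner_sub_left]
  linarith
end Uniq
section Rock
variable {E : Type*} [NormedAddCommGroup E] [InnerProductSpace ℝ E]

/-- Chains in `S` starting from `(x0, y0)`, with their accumulated value. -/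
inductive Reach (S : Set (E × E)) (x0 y0 : E) : E → E → ℝ → Prop
  | base : Reach S x0 y0 x0 y0 0
  | step {x y v x' y'} : Reach S x0 y0 x y v → (x', y') ∈ S →
      Reach S x0 y0 x' y' (v + ⟪x' - x, y⟫)

/-- Cyclical monotonicity. -/
def CycMono (S : Set (E × E)) : Prop :=
  ∀ x0 y0, (x0, y0) ∈ S → ∀ x y v, Reach S x0 y0 x y v → v + ⟪x0 - x, y⟫ ≤ 0

/-- Rockafellar potential. -/
noncomputable def pot (S : Set (E × E)) (x0 y0 : E) (z : E) : EReal :=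
  ⨆ p : {p : E × E × ℝ // Reach S x0 y0 p.1 p.2.1 p.2.2},
    ((p.1.2.2 + ⟪z - p.1.1, p.1.2.1⟫ : ℝ) : EReal)

theorem pot_le {S : Set (E × E)} {x0 y0 z : E} {a : EReal} :
    pot S x0 y0 z ≤ a ↔ ∀ x y v, Reach S x0 y0 x y v → ((v + ⟪z - x, y⟫ : ℝ) : EReal) ≤ a := by
  unfold pot
  rw [iSup_le_iff]
  exact ⟨fun h x y v hr => h ⟨(x, y, v), hr⟩, fun h p => h _ _ _ p.2⟩

theorem le_pot {S : Set (E × E)} {x0 y0 z x y : E} {v : ℝ} (h : Reach S x0 y0 x y v) :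
    ((v + ⟪z - x, y⟫ : ℝ) : EReal) ≤ pot S x0 y0 z := pot_le.1 le_rfl x y v h

theorem pot_ne_bot {S : Set (E × E)} {x0 y0 : E} (z : E) : pot S x0 y0 z ≠ ⊥ :=
  ne_bot_of_le_ne_bot (EReal.coe_ne_bot _) (le_pot Reach.base)

theorem pot_convex {S : Set (E × E)} {x0 y0 : E} : IsConvexEReal (pot S x0 y0) := by
  intro x y t a b ht ht1 hx hy
  rw [pot_le] at hx hy ⊢
  intro u w v hr
  have h1 := EReal.coe_le_coe_iff.1 (hx u w v hr)
  have h2 := EReal.coe_le_coe_iff.1 (hy u w v hr)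
  refine EReal.coe_le_coe_iff.2 ?_
  have e : t • x + (1 - t) • y - u = t • (x - u) + (1 - t) • (y - u) := by module
  rw [e, inner_add_left, real_inner_smul_left, real_inner_smul_left]
  nlinarith [mul_le_mul_of_nonneg_left h1 ht, mul_le_mul_of_nonneg_left h2 (sub_nonneg.2 ht1)]

theorem pot_ne_top {S : Set (E × E)} (hS : CycMono S) {x0 y0 : E} (h0 : (x0, y0) ∈ S)
    {x y : E} (h : (x, y) ∈ S) : pot S x0 y0 x ≠ ⊤ := by
  have : pot S x0 y0 x ≤ ((-⟪x0 - x, y⟫ : ℝ) : EReal) := by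
    rw [pot_le]
    intro u w v hr
    have := hS x0 y0 h0 _ _ _ (hr.step h)
    exact EReal.coe_le_coe_iff.2 (by linarith)
  exact ne_top_of_le_ne_top (EReal.coe_ne_top _) this

theorem pot_subgrad {S : Set (E × E)} {x0 y0 : E}
    {x y : E} (h : (x, y) ∈ S) (z : E) (hz : pot S x0 y0 z ≠ ⊤) :
    (pot S x0 y0 x).toReal + ⟪z - x, y⟫ ≤ (pot S x0 y0 z).toReal := by
  have : pot S x0 y0 x ≤ (((pot S x0 y0 z).toReal - ⟪z - x, y⟫ : ℝ) : EReal) := by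
    rw [pot_le]
    intro u w v hr
    have h1 := le_pot (z := z) (hr.step h)
    rw [← EReal.coe_toReal hz (pot_ne_bot z)] at h1
    have := EReal.coe_le_coe_iff.1 h1
    exact EReal.coe_le_coe_iff.2 (by linarith)
  have h2 := EReal.toReal_le_toReal this (pot_ne_bot x) (EReal.coe_ne_top _)
  rw [EReal.toReal_coe] at h2
  linarith

theorem reach_lim {ι : Type*} {F : Filter ι} {S : Set (E × E)} {Sn : ι → Set (E × E)}
    (hS : ∀ p ∈ S, ∀ U ∈ 𝓝 p, ∀ᶠ n in F, (U ∩ Sn n).Nonempty)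
    {x0 y0 x y : E} {v : ℝ} (h0 : (x0, y0) ∈ S) (hr : Reach S x0 y0 x y v) :
    ∀ U ∈ 𝓝 (x0, x, y, v), ∀ᶠ n in F, ∃ q ∈ U, ∃ y0', (q.1, y0') ∈ Sn n ∧
      Reach (Sn n) q.1 y0' q.2.1 q.2.2.1 q.2.2.2 := by
  induction hr with
  | base =>
    intro U hU
    have hc : Continuous (fun p : E × E => (p.1, p.1, p.2, (0:ℝ))) := by fun_prop
    filter_upwards [hS (x0, y0) h0 _ (hc.continuousAt (x := (x0, y0)) hU)] with n hn
    obtain ⟨p, hp, hpS⟩ := hn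
    exact ⟨_, hp, p.2, hpS, Reach.base⟩
  | @step x y v x' y' hr hS' ih =>
    intro U hU
    have hc : Continuous (fun p : (E × E × E × ℝ) × (E × E) =>
      (p.1.1, p.2.1, p.2.2, p.1.2.2.2 + ⟪p.2.1 - p.1.2.1, p.1.2.2.1⟫)) := by fun_prop
    have := hc.continuousAt (x := ((x0, x, y, v), (x', y'))) hU
    rw [Filter.mem_map, mem_nhds_prod_iff] at this
    obtain ⟨V, hV, W, hW, hVW⟩ := this
    filter_upwards [ih V hV, hS _ hS' W hW] with n h1 h2
    obtain ⟨q, hq, y0', h3, h4⟩ := h1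
    obtain ⟨p, hp, hpS⟩ := h2
    exact ⟨_, hVW (Set.mk_mem_prod hq hp), y0', h3, h4.step hpS⟩

theorem cycMono_lim {ι : Type*} {F : Filter ι} [F.NeBot] {S : Set (E × E)} {Sn : ι → Set (E × E)}
    (hS : ∀ p ∈ S, ∀ U ∈ 𝓝 p, ∀ᶠ n in F, (U ∩ Sn n).Nonempty)
    (hSn : ∀ n, CycMono (Sn n)) : CycMono S := by
  intro x0 y0 h0 x y v hr
  by_contra! hcon
  have hc : Continuous (fun q : E × E × E × ℝ => q.2.2.2 + ⟪q.1 - q.2.1, q.2.2.1⟫) := by fun_prop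
  have hU := hc.continuousAt (x := (x0, x, y, v)) (Ioi_mem_nhds hcon)
  obtain ⟨n, q, hq, y0', h1, h2⟩ := (reach_lim hS h0 hr _ hU).exists
  exact absurd (hSn n _ _ h1 _ _ _ h2) (not_le.2 hq)
end Rock

section Fin

theorem exists_opt {A B : Type*} [Fintype A] [Fintype B] (p : A → ℝ) (q : B → ℝ)
    (hp : ∀ a, 0 ≤ p a) (hq : ∀ b, 0 ≤ q b) (hp1 : ∑ a, p a = 1) (hq1 : ∑ b, q b = 1)
    (c : A → B → ℝ) :
    ∃ g : A → B → ℝ, ((∀ a b, 0 ≤ g a b) ∧ (∀ a, ∑ b, g a b = p a) ∧ (∀ b, ∑ a, g a b = q b)) ∧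
      ∀ g' : A → B → ℝ, ((∀ a b, 0 ≤ g' a b) ∧ (∀ a, ∑ b, g' a b = p a) ∧
        (∀ b, ∑ a, g' a b = q b)) → ∑ a, ∑ b, g' a b * c a b ≤ ∑ a, ∑ b, g a b * c a b := by
  let K : Set (A → B → ℝ) := {g | (∀ a b, 0 ≤ g a b) ∧ (∀ a, ∑ b, g a b = p a) ∧
    (∀ b, ∑ a, g a b = q b)}
  have hKc : IsClosed K := by
    have e : K = (⋂ a, ⋂ b, {g | 0 ≤ g a b}) ∩ ((⋂ a, {g | ∑ b, g a b = p a}) ∩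
        ⋂ b, {g | ∑ a, g a b = q b}) := by
      ext g; simp [K]
    rw [e]
    refine IsClosed.inter ?_ (IsClosed.inter ?_ ?_)
    · exact isClosed_iInter fun a => isClosed_iInter fun b =>
        isClosed_le continuous_const (by fun_prop)
    · exact isClosed_iInter fun a => isClosed_eq (by fun_prop) continuous_const
    · exact isClosed_iInter fun a => isClosed_eq (by fun_prop) continuous_const
  have hK : IsCompact K := by
    refine (isCompact_univ_pi (s := fun a => Set.univ.pi fun _ : B => Icc (0:ℝ) (p a))
      fun a => isCompact_univ_pi fun b => isCompact_Icc).of_isClosed_subset hKc ?_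
    intro g hg a _ b _
    refine ⟨hg.1 a b, ?_⟩
    rw [← hg.2.1 a]
    exact Finset.single_le_sum (f := fun b => g a b) (fun b _ => hg.1 a b) (Finset.mem_univ b)
  have hne : K.Nonempty := by
    refine ⟨fun a b => p a * q b, fun a b => mul_nonneg (hp a) (hq b), fun a => ?_, fun b => ?_⟩
    · rw [← Finset.mul_sum, hq1, mul_one]
    · rw [← Finset.sum_mul, hp1, one_mul]
  obtain ⟨g, hg, hmax⟩ := hK.exists_isMaxOn hne
    (f := fun g : A → B → ℝ => ∑ a, ∑ b, g a b * c a b) (by fun_prop)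
  exact ⟨g, hg, fun g' hg' => hmax hg'⟩

variable {E : Type*} [NormedAddCommGroup E] [InnerProductSpace ℝ E]

theorem opt_cycMono {A B : Type*} [Fintype A] [Fintype B] (p : A → ℝ) (q : B → ℝ)
    (X : A → E) (Y : B → E) (g : A → B → ℝ)
    (hg : (∀ a b, 0 ≤ g a b) ∧ (∀ a, ∑ b, g a b = p a) ∧ (∀ b, ∑ a, g a b = q b))
    (hopt : ∀ g' : A → B → ℝ, ((∀ a b, 0 ≤ g' a b) ∧ (∀ a, ∑ b, g' a b = p a) ∧
        (∀ b, ∑ a, g' a b = q b)) →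
        ∑ a, ∑ b, g' a b * ⟪X a, Y b⟫ ≤ ∑ a, ∑ b, g a b * ⟪X a, Y b⟫) :
    CycMono {z : E × E | ∃ a b, 0 < g a b ∧ z = (X a, Y b)} := by
  classical
  intro x0 y0 h0 x y v hr
  obtain ⟨a0, b0, h00, e0⟩ := h0
  obtain ⟨rfl, rfl⟩ := Prod.mk.inj e0
  -- elementary matrices
  let e : A → B → A → B → ℝ := fun a b a' b' => (if a' = a then 1 else 0) * (if b' = b then 1 else 0)
  have e_row : ∀ a b a', ∑ b', e a b a' b' = if a' = a then 1 else 0 := by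
    intro a b a'; simp only [e]; rw [← Finset.mul_sum]; simp
  have e_col : ∀ a b b', ∑ a', e a b a' b' = if b' = b then 1 else 0 := by
    intro a b a'; simp only [e]; rw [← Finset.sum_mul]; simp
  have e_val : ∀ a b, ∑ a', ∑ b', e a b a' b' * ⟪X a', Y b'⟫ = ⟪X a, Y b⟫ := by
    intro a b; simp [e]
  have e_nn : ∀ a b a' b', 0 ≤ e a b a' b' := by
    intro a b a' b'; simp only [e]; positivity
  have e_z : ∀ a b a' b', 0 < g a b → g a' b' = 0 → e a b a' b' = 0 := by
    intro a b a' b' h1 h2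
    simp only [e]
    by_cases ha : a' = a
    · by_cases hb : b' = b
      · subst ha hb; exact absurd h2 h1.ne'
      · simp [hb]
    · simp [ha]
  have key : ∃ a b, 0 < g a b ∧ x = X a ∧ y = Y b ∧ ∃ δ : A → B → ℝ,
      (∀ a' b', g a' b' = 0 → 0 ≤ δ a' b') ∧
      (∀ a', ∑ b', δ a' b' = (if a' = a then 1 else 0) - (if a' = a0 then 1 else 0)) ∧
      (∀ b', ∑ a', δ a' b' = 0) ∧ ∑ a', ∑ b', δ a' b' * ⟪X a', Y b'⟫ = v := by
    induction hr with
    | base => exact ⟨a0, b0, h00, rfl, rfl, 0, by simp, by simp, by simp, by simp⟩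
    | @step x y v x' y' hr hS' ih =>
      obtain ⟨a, b, hab, rfl, rfl, δ, d1, d2, d3, d4⟩ := ih
      obtain ⟨a', b', hab', e1⟩ := hS'
      obtain ⟨rfl, rfl⟩ := Prod.mk.inj e1
      refine ⟨a', b', hab', rfl, rfl, fun s t => δ s t + e a' b s t - e a b s t, ?_, ?_, ?_, ?_⟩
      · intro s t h
        have := d1 s t h
        have := e_nn a' b s t
        have := e_z a b s t hab h
        linarith
      · intro s
        rw [Finset.sum_sub_distrib, Finset.sum_add_distrib, d2, e_row, e_row]; ring
      · intro s
        rw [Finset.sum_sub_distrib, Finset.sum_add_distrib, d3, e_col, e_col]; ring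
      · simp only [sub_mul, add_mul, Finset.sum_sub_distrib, Finset.sum_add_distrib]
        rw [d4, e_val, e_val, inner_sub_left]; ring
  obtain ⟨a, b, hab, rfl, rfl, δ0, d1, d2, d3, d4⟩ := key
  let δ : A → B → ℝ := fun s t => δ0 s t + e a0 b s t - e a b s t
  have c1 : ∀ s t, g s t = 0 → 0 ≤ δ s t := by
    intro s t h
    have := d1 s t h
    have := e_nn a0 b s t
    have := e_z a b s t hab h
    simp only [δ]; linarith
  have c2 : ∀ s, ∑ t, δ s t = 0 := by
    intro s
    simp only [δ]
    rw [Finset.sum_sub_distrib, Finset.sum_add_distrib, d2, e_row, e_row]; ring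
  have c3 : ∀ t, ∑ s, δ s t = 0 := by
    intro s
    simp only [δ]
    rw [Finset.sum_sub_distrib, Finset.sum_add_distrib, d3, e_col, e_col]; ring
  have c4 : ∑ s, ∑ t, δ s t * ⟪X s, Y t⟫ = v + ⟪X a0 - X a, Y b⟫ := by
    simp only [δ, sub_mul, add_mul, Finset.sum_sub_distrib, Finset.sum_add_distrib]
    rw [d4, e_val, e_val, inner_sub_left]; ring
  have hε : ∃ ε : ℝ, 0 < ε ∧ ∀ s t, 0 ≤ g s t + ε * δ s t := by
    have h : ∀ s t, ∀ᶠ ε in 𝓝[>] (0:ℝ), 0 ≤ g s t + ε * δ s t := by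
      intro s t
      rcases (hg.1 s t).eq_or_lt with h | h
      · filter_upwards [self_mem_nhdsWithin] with ε hε
        rw [← h, zero_add]
        exact mul_nonneg (le_of_lt hε) (c1 s t h.symm)
      · have hc : Continuous fun ε : ℝ => g s t + ε * δ s t := by fun_prop
        have := hc.continuousAt (x := 0) (Ioi_mem_nhds (show 0 < g s t + 0 * δ s t by simpa using h))
        filter_upwards [mem_nhdsWithin_of_mem_nhds this] with ε hε
        exact le_of_lt hε
    have h2 : ∀ᶠ ε in 𝓝[>] (0:ℝ), ∀ s t, 0 ≤ g s t + ε * δ s t :=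
      eventually_all.2 fun s => eventually_all.2 fun t => h s t
    obtain ⟨ε, h3, h4⟩ := (h2.and self_mem_nhdsWithin).exists
    exact ⟨ε, h4, h3⟩
  obtain ⟨ε, hε, hεg⟩ := hε
  have := hopt (fun s t => g s t + ε * δ s t) ⟨hεg, fun s => by
      rw [Finset.sum_add_distrib, ← Finset.mul_sum, c2, hg.2.1]; ring, fun t => by
      rw [Finset.sum_add_distrib, ← Finset.mul_sum, c3, hg.2.2]; ring⟩
  simp only [add_mul, Finset.sum_add_distrib, mul_assoc, ← Finset.mul_sum] at this
  rw [c4] at this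
  have h5 : ε * (v + ⟪X a0 - X a, Y b⟫) ≤ 0 := by linarith
  exact nonpos_of_mul_nonpos_right h5 hε
end Fin

section Coupling
variable {E : Type*} [NormedAddCommGroup E] [InnerProductSpace ℝ E] [FiniteDimensional ℝ E]
  [MeasurableSpace E] [BorelSpace E]

theorem map_simple (μ : Measure E) (s : SimpleFunc E E) :
    μ.map s = ∑ a : s.range, μ (s ⁻¹' {(a : E)}) • Measure.dirac (a : E) := by
  refine Measure.ext fun U hU => ?_
  rw [Measure.map_apply s.measurable hU, Measure.finsetSum_apply]
  have h1 := SimpleFunc.map_lintegral (μ := μ) (U.indicator (fun _ => (1 : ENNReal))) s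
  rw [← SimpleFunc.lintegral_eq_lintegral] at h1
  have h2 : ∫⁻ x, (s.map (U.indicator (fun _ => (1 : ENNReal)))) x ∂μ = μ (s ⁻¹' U) := by
    rw [← lintegral_indicator_one (s.measurable hU)]
    rfl
  rw [← h2, h1, ← Finset.sum_coe_sort]
  refine Finset.sum_congr rfl fun a _ => ?_
  rw [Measure.smul_apply, Measure.dirac_apply' _ hU, smul_eq_mul, mul_comm]
  rfl

theorem disc (μ ν : Measure E) [IsProbabilityMeasure μ] [IsProbabilityMeasure ν]
    (s t : SimpleFunc E E) :
    ∃ γ : Measure (E × E), γ.map Prod.fst = μ.map s ∧ γ.map Prod.snd = ν.map t ∧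
      ∃ S, CycMono S ∧ γ Sᶜ = 0 := by
  have hsum : ∀ (μ : Measure E) [IsProbabilityMeasure μ] (s : SimpleFunc E E),
      ∑ a : s.range, μ.real (s ⁻¹' {(a : E)}) = 1 := by
    intro μ _ s
    have h := map_simple μ s
    have h1 : (μ.map s) univ = 1 := by
      rw [Measure.map_apply s.measurable MeasurableSet.univ]; simp
    rw [h, Measure.finsetSum_apply] at h1
    simp only [Measure.smul_apply, measure_univ, smul_eq_mul, mul_one] at h1
    simp only [Measure.real]
    rw [← ENNReal.toReal_sum (fun a _ => measure_ne_top _ _), h1, ENNReal.toReal_one]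
  obtain ⟨g, hg, hopt⟩ := exists_opt (fun a : s.range => μ.real (s ⁻¹' {(a : E)}))
    (fun b : t.range => ν.real (t ⁻¹' {(b : E)})) (fun _ => measureReal_nonneg)
    (fun _ => measureReal_nonneg) (hsum μ s) (hsum ν t) (fun a b => ⟪(a : E), (b : E)⟫)
  have hcm := opt_cycMono _ _ (fun a : s.range => (a : E)) (fun b : t.range => (b : E)) g hg hopt
  have hof : ∀ (μ : Measure E) [IsProbabilityMeasure μ] (A : Set E),
    ENNReal.ofReal (μ.real A) = μ A := fun μ _ A => ofReal_measureReal
  refine ⟨∑ a, ∑ b, ENNReal.ofReal (g a b) • Measure.dirac ((a : E), (b : E)), ?_, ?_, _, hcm, ?_⟩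
  · rw [map_simple, Measure.map_finset_sum measurable_fst.aemeasurable]
    refine Finset.sum_congr rfl fun a _ => ?_
    rw [Measure.map_finset_sum measurable_fst.aemeasurable]
    simp only [Measure.map_smul, Measure.map_dirac' measurable_fst]
    rw [← Finset.sum_smul, ← ENNReal.ofReal_sum_of_nonneg (fun b _ => hg.1 a b), hg.2.1, hof]
  · rw [map_simple, Finset.sum_comm, Measure.map_finset_sum measurable_snd.aemeasurable]
    refine Finset.sum_congr rfl fun b _ => ?_
    rw [Measure.map_finset_sum measurable_snd.aemeasurable]
    simp only [Measure.map_smul, Measure.map_dirac' measurable_snd]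
    rw [← Finset.sum_smul, ← ENNReal.ofReal_sum_of_nonneg (fun a _ => hg.1 a b), hg.2.2, hof]
  · simp only [Measure.finsetSum_apply, Measure.smul_apply, smul_eq_mul]
    refine Finset.sum_eq_zero fun a _ => Finset.sum_eq_zero fun b _ => ?_
    rcases (hg.1 a b).eq_or_lt with h | h
    · rw [← h]; simp
    · rw [Measure.dirac_apply, indicator_of_notMem, mul_zero]
      exact fun hn => hn ⟨a, b, h, rfl⟩

theorem approx (μ : ProbabilityMeasure E) : ∃ s : ℕ → SimpleFunc E E,
    Tendsto (fun n => μ.map (s n).measurable.aemeasurable) atTop (𝓝 μ) := by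
  refine ⟨fun n => SimpleFunc.approxOn id measurable_id univ 0 (mem_univ _) n, ?_⟩
  rw [ProbabilityMeasure.tendsto_iff_forall_integral_tendsto]
  intro f
  have : ∀ n, ∫ ω, f ω ∂((μ.map (SimpleFunc.approxOn id measurable_id univ 0
      (mem_univ _) n).measurable.aemeasurable : ProbabilityMeasure E) : Measure E) =
      ∫ ω, f (SimpleFunc.approxOn id measurable_id univ (0 : E) (mem_univ _) n ω) ∂(μ : Measure E) := by
    intro n
    rw [ProbabilityMeasure.toMeasure_map]
    exact integral_map (SimpleFunc.measurable _).aemeasurable f.continuous.aestronglyMeasurable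
  simp only [this]
  refine tendsto_integral_of_dominated_convergence (fun _ => ‖f‖) ?_ (integrable_const _) ?_ ?_
  · intro n
    exact (f.continuous.measurable.comp (SimpleFunc.measurable _)).aestronglyMeasurable
  · intro n
    exact Eventually.of_forall fun x => f.norm_coe_le_norm _
  · refine Eventually.of_forall fun x => ?_
    refine (f.continuous.tendsto x).comp ?_
    exact SimpleFunc.tendsto_approxOn measurable_id (mem_univ _) (by simp)

theorem exists_coupling (μ ν : Measure E) [IsProbabilityMeasure μ] [IsProbabilityMeasure ν] :
    ∃ γ : Measure (E × E), γ.map Prod.fst = μ ∧ γ.map Prod.snd = ν ∧ CycMono γ.support := by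
  let μ' : ProbabilityMeasure E := ⟨μ, inferInstance⟩
  let ν' : ProbabilityMeasure E := ⟨ν, inferInstance⟩
  obtain ⟨s, hs⟩ := approx μ'
  obtain ⟨t, ht⟩ := approx ν'
  have hd := fun n => disc μ ν (s n) (t n)
  choose γ h1 h2 S hS hS0 using hd
  have hprob : ∀ n, IsProbabilityMeasure (γ n) := by
    intro n
    constructor
    have : (γ n).map Prod.fst univ = 1 := by
      rw [h1, Measure.map_apply (s n).measurable MeasurableSet.univ]; simp
    rwa [Measure.map_apply measurable_fst MeasurableSet.univ, preimage_univ] at this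
  let G : ℕ → ProbabilityMeasure (E × E) := fun n => ⟨γ n, hprob n⟩
  have G1 : ∀ n, (G n).map continuous_fst.measurable.aemeasurable =
      μ'.map (s n).measurable.aemeasurable := fun n => Subtype.ext (h1 n)
  have G2 : ∀ n, (G n).map continuous_snd.measurable.aemeasurable =
      ν'.map (t n).measurable.aemeasurable := fun n => Subtype.ext (h2 n)
  have hcl : ∀ {u : ℕ → ProbabilityMeasure E} {l : ProbabilityMeasure E}, Tendsto u atTop (𝓝 l) →
      IsTightMeasureSet {((μ : ProbabilityMeasure E) : Measure E) | μ ∈ range u} := by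
    intro u l h
    exact isTightMeasureSet_of_isCompact_closure
      (h.isCompact_insert_range.closure_of_subset (subset_insert _ _))
  have htight : IsTightMeasureSet
      {((μ : ProbabilityMeasure (E × E)) : Measure (E × E)) | μ ∈ range G} := by
    refine IsTightMeasureSet.prodMk ((hcl hs).subset ?_) ((hcl ht).subset ?_)
    · rintro _ ⟨_, ⟨_, ⟨n, rfl⟩, rfl⟩, rfl⟩
      exact ⟨_, ⟨n, rfl⟩, (h1 n).symm⟩
    · rintro _ ⟨_, ⟨_, ⟨n, rfl⟩, rfl⟩, rfl⟩
      exact ⟨_, ⟨n, rfl⟩, (h2 n).symm⟩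
  have hcomp := isCompact_closure_of_isTightMeasureSet htight
  obtain ⟨g, -, k, hk, hg⟩ := hcomp.isSeqCompact (x := G) (fun n => subset_closure ⟨n, rfl⟩)
  refine ⟨g, ?_, ?_, ?_⟩
  · have a1 := ProbabilityMeasure.tendsto_map_of_tendsto_of_continuous _ _ hg continuous_fst
    have a2 := hs.comp hk.tendsto_atTop
    have a3 := tendsto_nhds_unique (a1.congr fun n => G1 (k n)) a2
    exact congrArg (fun m : ProbabilityMeasure E => (m : Measure E)) a3
  · have a1 := ProbabilityMeasure.tendsto_map_of_tendsto_of_continuous _ _ hg continuous_snd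
    have a2 := ht.comp hk.tendsto_atTop
    have a3 := tendsto_nhds_unique (a1.congr fun n => G2 (k n)) a2
    exact congrArg (fun m : ProbabilityMeasure E => (m : Measure E)) a3
  · refine cycMono_lim (F := atTop) (Sn := fun n => S (k n)) ?_ (fun n => hS (k n))
    intro p hp U hU
    have hpos : 0 < (g : Measure (E × E)) (interior U) :=
      (Measure.mem_support_iff_forall p).1 hp _ (interior_mem_nhds.2 hU)
    have hl := hpos.trans_le (ProbabilityMeasure.le_liminf_measure_open_of_tendsto hg
      (isOpen_interior (s := U)))
    filter_upwards [eventually_lt_of_lt_liminf hl] with n hn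
    by_contra hcon
    rw [not_nonempty_iff_eq_empty, ← disjoint_iff_inter_eq_empty] at hcon
    have : γ (k n) (interior U) = 0 :=
      measure_mono_null (interior_subset.trans hcon.subset_compl_right) (hS0 (k n))
    exact hn.ne' this
end Coupling

theorem main_thm {E : Type*} [NormedAddCommGroup E] [InnerProductSpace ℝ E]
    [FiniteDimensional ℝ E] [MeasurableSpace E] [BorelSpace E] (m μ ν : Measure E)
    [m.IsAddHaarMeasure] [IsProbabilityMeasure μ] [IsProbabilityMeasure ν] (hac : μ ≪ m) :
    ∃ (φ : E → EReal) (T : E → E),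
      (∀ x, φ x ≠ ⊥) ∧ IsConvexEReal φ ∧ Measurable T ∧
      (∀ᵐ x ∂μ, φ x ≠ ⊤ ∧ HasGradientAt (fun z => (φ z).toReal) (T x) x) ∧
      μ.map T = ν ∧
      (∀ (φ' : E → EReal) (T' : E → E),
        (∀ x, φ' x ≠ ⊥) → IsConvexEReal φ' → Measurable T' →
        (∀ᵐ x ∂μ, φ' x ≠ ⊤ ∧ HasGradientAt (fun z => (φ' z).toReal) (T' x) x) →
        μ.map T' = ν →
        T' =ᵐ[μ] T) := by
  obtain ⟨γ, hγ1, hγ2, hcm⟩ := exists_coupling μ ν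
  have hS : ∀ᵐ p ∂γ, p ∈ γ.support := Measure.support_mem_ae
  have hne : γ ≠ 0 := by
    rintro rfl
    rw [Measure.map_zero] at hγ1
    exact (IsProbabilityMeasure.ne_zero μ) hγ1.symm
  obtain ⟨⟨x0, y0⟩, h0⟩ := Measure.nonempty_support hne
  set φ := pot γ.support x0 y0 with hφ
  set f : E → ℝ := fun z => (φ z).toReal with hf
  have hbot : ∀ x, φ x ≠ ⊥ := pot_ne_bot
  have hconv : IsConvexEReal φ := pot_convex
  have hcx := convexOn_toReal hbot hconv
  -- almost every point lies in the interior of the domain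
  have hmemint : ∀ᵐ x ∂μ, x ∈ interior {x | φ x ≠ ⊤} := by
    have h1 : ∀ᵐ p ∂γ, p.1 ∈ closure {x | φ x ≠ ⊤} := by
      filter_upwards [hS] with p hp
      exact subset_closure (pot_ne_top hcm h0 (x := p.1) (y := p.2) hp)
    have h2 : ∀ᵐ x ∂μ, x ∈ closure {x | φ x ≠ ⊤} := by
      rw [← hγ1]
      exact (ae_map_iff measurable_fst.aemeasurable
        (isClosed_closure (s := {x | φ x ≠ ⊤})).measurableSet).2 h1
    have h3 : ∀ᵐ x ∂μ, x ∉ frontier {x | φ x ≠ ⊤} :=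
      hac (measure_eq_zero_iff_ae_notMem.1 (hcx.1.addHaar_frontier m))
    filter_upwards [h2, h3] with x hx hx'
    by_contra hc
    exact hx' ⟨hx, hc⟩
  have hdiff : ∀ᵐ x ∂μ, DifferentiableAt ℝ f x := by
    filter_upwards [hmemint, hac (ae_diff m hcx)] with x h1 h2 using h2 h1
  let T : E → E := fun x => gradient f x
  have hTm : Measurable T :=
    (InnerProductSpace.toDual ℝ E).symm.continuous.measurable.comp (measurable_fderiv ℝ f)
  have hgrad : ∀ᵐ x ∂μ, φ x ≠ ⊤ ∧ HasGradientAt f (T x) x := by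
    filter_upwards [hmemint, hdiff] with x h1 h2
    exact ⟨interior_subset h1, h2.hasGradientAt⟩
  have hfst : Tendsto (Prod.fst : E × E → E) (ae γ) (ae μ) := by
    rw [← hγ1]; exact Measure.tendsto_ae_map measurable_fst.aemeasurable
  have hTν : μ.map T = ν := by
    have h1 : (fun p : E × E => T p.1) =ᵐ[γ] Prod.snd := by
      filter_upwards [hS, hfst.eventually hmemint, hfst.eventually hgrad] with p hp h1 h2
      exact (eq_grad_of_subgrad h1 h2.2
        (fun z hz => pot_subgrad (x := p.1) (y := p.2) hp z hz)).symm
    rw [← hγ1, Measure.map_map hTm measurable_fst, ← hγ2]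
    exact Measure.map_congr h1
  refine ⟨φ, T, hbot, hconv, hTm, hgrad, hTν, ?_⟩
  intro φ' T' hbot' hconv' hTm' hgrad' hTν'
  have hcx' := convexOn_toReal hbot' hconv'
  have hu := uniq_core (μ := μ) (D := {x | φ x ≠ ⊤}) (D' := {x | φ' x ≠ ⊤}) (f := f)
    (f' := fun z => (φ' z).toReal) hTm hTm'
    (by filter_upwards [hgrad] with x hx
        exact ⟨hx.1, subgrad_of_hasGradientAt hcx hx.1 hx.2⟩)
    (by filter_upwards [hgrad'] with x hx
        exact ⟨hx.1, subgrad_of_hasGradientAt hcx' hx.1 hx.2⟩)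
    (hTν'.trans hTν.symm)
  filter_upwards [hu, hmemint, hgrad] with x h1 h2 h3
  exact eq_grad_of_subgrad h2 h3.2 h1

end BM

/-- Existence and uniqueness of the μ-quantile map (Brenier–McCann): if `μ` is absolutely
continuous with respect to Lebesgue measure, there is a convex `φ : ℝ^d → ℝ ∪ {+∞}`,
differentiable `μ`-a.e. with gradient map `T = ∇φ`, such that `∇φ` pushes `μ` forward to
`ν`; moreover the map is unique: any other convex `φ̃` whose gradient pushes `μ` forward
to `ν` satisfies `∇φ̃ = ∇φ` μ-almost everywhere. -/
theorem brenier_mccann_quantile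
    {d : ℕ} (μ ν : Measure (EuclideanSpace ℝ (Fin d)))
    [IsProbabilityMeasure μ] [IsProbabilityMeasure ν]
    (hμac : μ ≪ (volume : Measure (EuclideanSpace ℝ (Fin d)))) :
    ∃ (φ : EuclideanSpace ℝ (Fin d) → EReal)
      (T : EuclideanSpace ℝ (Fin d) → EuclideanSpace ℝ (Fin d)),
      -- φ is convex, with values in ℝ ∪ {+∞}
      (∀ x, φ x ≠ ⊥) ∧ IsConvexEReal φ ∧ Measurable T ∧
      -- φ is differentiable μ-a.e., with gradient T = ∇φ
      (∀ᵐ x ∂μ, φ x ≠ ⊤ ∧ HasGradientAt (fun z => (φ z).toReal) (T x) x) ∧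
      -- ∇φ pushes μ forward to ν
      μ.map T = ν ∧
      -- uniqueness: the gradient of any other such convex function agrees μ-a.e.
      (∀ (φ' : EuclideanSpace ℝ (Fin d) → EReal)
         (T' : EuclideanSpace ℝ (Fin d) → EuclideanSpace ℝ (Fin d)),
        (∀ x, φ' x ≠ ⊥) → IsConvexEReal φ' → Measurable T' →
        (∀ᵐ x ∂μ, φ' x ≠ ⊤ ∧ HasGradientAt (fun z => (φ' z).toReal) (T' x) x) →
        μ.map T' = ν →
        T' =ᵐ[μ] T) := by
  exact BM.main_thm volume μ ν hμac
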